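/- Let U ⊆ ℝ³ be an open set, x : ℝ³ → ℝ³ a map that is C² on U, and a_{13}, a_{31}, a_{23}, a_{32} : ℝ³ → ℝ functions such that on U: ∂_1∂_3 x = a_{13} ∂_1 x + a_{31} ∂_3 x and ∂_2∂_3 x = a_{23} ∂_2 x + a_{32} ∂_3 x. If ⟨∂_1 x, ∂_2 x⟩ = 0 everywhere on U, then a_{31} ⟨∂_2 x, ∂_3 x⟩ + a_{32} ⟨∂_1 x, ∂_3 x⟩ = 0 everywhere on U. -/

import Mathlib

open RealInnerProductSpace

/-- `∂_i` of a vector-valued map: the derivative in the direction of the `i`-th standard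
basis vector of `ℝ³`. -/
noncomputable def pd (x : EuclideanSpace ℝ (Fin 3) → EuclideanSpace ℝ (Fin 3))
    (i : Fin 3) (p : EuclideanSpace ℝ (Fin 3)) : EuclideanSpace ℝ (Fin 3) :=
  fderiv ℝ x p (EuclideanSpace.single i 1)

/-- Second partial derivatives are the values of the second Fréchet derivative. -/
lemma pd_pd_eq {x : EuclideanSpace ℝ (Fin 3) → EuclideanSpace ℝ (Fin 3)}
    {p : EuclideanSpace ℝ (Fin 3)} (h : ContDiffAt ℝ 2 x p) (i j : Fin 3) :
    pd (pd x i) j p =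
      fderiv ℝ (fderiv ℝ x) p (EuclideanSpace.single j 1) (EuclideanSpace.single i 1) := by
  have hd : DifferentiableAt ℝ (fderiv ℝ x) p :=
    (h.fderiv_right (m := 1) (by norm_num)).differentiableAt (by norm_num)
  have hi : HasFDerivAt (pd x i) _ p :=
    hd.hasFDerivAt.clm_apply (hasFDerivAt_const (EuclideanSpace.single i (1 : ℝ)) p)
  rw [pd, hi.fderiv]
  simp

/-- Partial derivatives of a `C²` map commute. -/
lemma pd_pd_comm {x : EuclideanSpace ℝ (Fin 3) → EuclideanSpace ℝ (Fin 3)}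
    {p : EuclideanSpace ℝ (Fin 3)} (h : ContDiffAt ℝ 2 x p) (i j : Fin 3) :
    pd (pd x i) j p = pd (pd x j) i p := by
  rw [pd_pd_eq h, pd_pd_eq h]
  exact (h.isSymmSndFDerivAt (by simp)).eq _ _

/-- First partial derivatives of a `C²` map are differentiable. -/
lemma differentiableAt_pd {x : EuclideanSpace ℝ (Fin 3) → EuclideanSpace ℝ (Fin 3)}
    {p : EuclideanSpace ℝ (Fin 3)} (h : ContDiffAt ℝ 2 x p) (i : Fin 3) :
    DifferentiableAt ℝ (pd x i) p :=
  ((h.fderiv_right (m := 1) (by norm_num)).differentiableAt (by norm_num)).clm_apply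
    (differentiableAt_const _)

/-- For a map `x` which is `C²` on an open set `U` and satisfies
`∂₁∂₃x = a₁₃ ∂₁x + a₃₁ ∂₃x` and `∂₂∂₃x = a₂₃ ∂₂x + a₃₂ ∂₃x` on `U`, the condition
`⟨∂₁x, ∂₂x⟩ = 0` on `U` implies `a₃₁⟨∂₂x, ∂₃x⟩ + a₃₂⟨∂₁x, ∂₃x⟩ = 0` on `U`.
(Indices `1, 2, 3` correspond to `0, 1, 2 : Fin 3`.) -/
theorem dependent_orthogonality_conditions
    (U : Set (EuclideanSpace ℝ (Fin 3))) (hU : IsOpen U)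
    (x : EuclideanSpace ℝ (Fin 3) → EuclideanSpace ℝ (Fin 3))
    (hx : ContDiffOn ℝ 2 x U)
    (a13 a31 a23 a32 : EuclideanSpace ℝ (Fin 3) → ℝ)
    (h13 : ∀ p ∈ U, pd (pd x 2) 0 p = a13 p • pd x 0 p + a31 p • pd x 2 p)
    (h23 : ∀ p ∈ U, pd (pd x 2) 1 p = a23 p • pd x 1 p + a32 p • pd x 2 p)
    (horth : ∀ p ∈ U, ⟪pd x 0 p, pd x 1 p⟫ = 0) :
    ∀ p ∈ U, a31 p * ⟪pd x 1 p, pd x 2 p⟫ + a32 p * ⟪pd x 0 p, pd x 2 p⟫ = 0 := by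
  intro p hp
  have h : ContDiffAt ℝ 2 x p := hx.contDiffAt (hU.mem_nhds hp)
  have hzero : (fun q => ⟪pd x 0 q, pd x 1 q⟫) =ᶠ[nhds p] fun _ => (0 : ℝ) := by
    filter_upwards [hU.mem_nhds hp] with q hq using horth q hq
  have hderiv := fderiv_inner_apply ℝ (differentiableAt_pd h 0) (differentiableAt_pd h 1)
    (EuclideanSpace.single 2 1)
  rw [hzero.fderiv_eq] at hderiv
  change _ = ⟪pd x 0 p, pd (pd x 1) 2 p⟫ + ⟪pd (pd x 0) 2 p, pd x 1 p⟫ at hderiv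
  rw [pd_pd_comm h 1 2, pd_pd_comm h 0 2, h13 p hp, h23 p hp] at hderiv
  simp only [inner_add_left, inner_add_right, real_inner_smul_left, real_inner_smul_right,
    horth p hp, fderiv_fun_const, Pi.zero_apply, zero_apply] at hderiv
  rw [real_inner_comm (pd x 2 p) (pd x 1 p)]
  linarith
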